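/- Let α ≥ -1 and suppose 2(k−1) < p ≤ 2k for some integer k ≥ 2. Then for every f holomorphic on 𝔻, ‖f‖_{A^p_{(p/2)(α+2)−2}} ≤ (p/2)^{1/p} · (k−1)^{1/2 − k/p} · k^{(k−1)/p − 1/2} · ‖f‖_{A²_α}. -/

import Mathlib

open MeasureTheory Set Filter
open scoped ENNReal NNReal Topology

noncomputable section

/-- The open unit disk in `ℂ`. -/
def unitDisk : Set ℂ := Metric.ball 0 1

/-- `c_β(n) = Γ(n+β)/(Γ(β)·n!)`. -/
def ccoef (β : ℝ) (n : ℕ) : ℝ := Real.Gamma (n + β) / (Real.Gamma β * n.factorial)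

/-- The `n`-th Taylor coefficient of `f` at the origin. -/
def taylorCoeff (f : ℂ → ℂ) (n : ℕ) : ℂ := iteratedDeriv n f 0 / n.factorial

/-- The square of the `A²_α` norm, `∑ |a_n|²/c_{α+2}(n)`, valued in `[0,∞]`. -/
def A2normSq (α : ℝ) (f : ℂ → ℂ) : ℝ≥0∞ :=
  ∑' n : ℕ, ENNReal.ofReal (‖taylorCoeff f n‖ ^ 2 / ccoef (α + 2) n)

/-- The `A²_α` norm (Hardy `H²` norm when `α = -1`). -/
def A2norm (α : ℝ) (f : ℂ → ℂ) : ℝ≥0∞ := A2normSq α f ^ (1 / 2 : ℝ)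

/-- The `p`-th power of the weighted Bergman norm `‖f‖_{A^p_β}`, valued in `[0,∞]`:
`(β+1) ∫_𝔻 (1-|z|²)^β |f z|^p dA(z)` with `dA` the normalized area measure. -/
def ApIntPow (p β : ℝ) (f : ℂ → ℂ) : ℝ≥0∞ :=
  ENNReal.ofReal (β + 1) *
    (∫⁻ z in unitDisk, ENNReal.ofReal ((1 - ‖z‖ ^ 2) ^ β * ‖f z‖ ^ p)) / ENNReal.ofReal Real.pi

/-- The weighted Bergman norm `‖f‖_{A^p_β}`, valued in `[0,∞]`. -/
def ApNorm (p β : ℝ) (f : ℂ → ℂ) : ℝ≥0∞ := ApIntPow p β f ^ (1 / p)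

/-- The inner integral `∫₀¹ s^{α+1}/(1-(1-|z|²)s) ds`, valued in `[0,∞]`. -/
def Hinner (α : ℝ) (z : ℂ) : ℝ≥0∞ :=
  ∫⁻ s in Set.Ioo (0 : ℝ) 1, ENNReal.ofReal (s ^ (α + 1) / (1 - (1 - ‖z‖ ^ 2) * s))

/-- The quantity `F_p(f)`. -/
def Ffun (α p : ℝ) (f : ℂ → ℂ) : ℝ≥0∞ :=
  ENNReal.ofReal (‖f 0‖ ^ p) +
    ENNReal.ofReal (p / 2) *
      (∫⁻ z in unitDisk,
        ENNReal.ofReal (‖deriv f z‖ ^ 2 * ‖f z‖ ^ (p - 2) * (1 - ‖z‖ ^ 2) ^ (p * (α + 2) / 2)) *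
          Hinner α z) / ENNReal.ofReal Real.pi

/-- The quantity `G_p(f)`. -/
def Gfun (α p : ℝ) (f : ℂ → ℂ) : ℝ≥0∞ :=
  ENNReal.ofReal (p / (2 * (α + 2))) *
    (∫⁻ z in unitDisk,
      ENNReal.ofReal (‖deriv f z‖ ^ 2 * ‖f z‖ ^ (p - 2) * (1 - ‖z‖ ^ 2) ^ (p * (α + 2) / 2))) /
    ENNReal.ofReal Real.pi

lemma ccoef_pos {c : ℝ} (hc : 0 < c) (n : ℕ) : 0 < ccoef c n := by
  unfold ccoef
  have h1 : 0 < Real.Gamma (n + c) := Real.Gamma_pos_of_pos (by positivity)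
  have h2 : 0 < Real.Gamma c := Real.Gamma_pos_of_pos hc
  positivity

lemma ccoef_zero {c : ℝ} (hc : 0 < c) : ccoef c 0 = 1 := by
  have h2 : 0 < Real.Gamma c := Real.Gamma_pos_of_pos hc
  simp [ccoef, h2.ne']

lemma ccoef_succ {c : ℝ} (hc : 0 < c) (n : ℕ) :
    (n + 1) * ccoef c (n + 1) = (n + c) * ccoef c n := by
  have h2 : Real.Gamma c ≠ 0 := (Real.Gamma_pos_of_pos hc).ne'
  have h : Real.Gamma (((n + 1 : ℕ) : ℝ) + c) = (n + c) * Real.Gamma (n + c) := by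
    rw [← Real.Gamma_add_one (by positivity)]
    congr 1
    push_cast
    ring
  unfold ccoef
  rw [h, Nat.factorial_succ]
  push_cast
  field_simp

open Finset in
/-- Vandermonde's convolution identity for the coefficients of `(1 - x)^(-c)`. -/
lemma sum_antidiagonal_ccoef {c d : ℝ} (hc : 0 < c) (hd : 0 < d) (n : ℕ) :
    ∑ ij ∈ antidiagonal n, ccoef c ij.1 * ccoef d ij.2 = ccoef (c + d) n := by
  induction n with
  | zero => simp [ccoef_zero hc, ccoef_zero hd, ccoef_zero (add_pos hc hd)]
  | succ n ih =>
    have hn : ((n : ℝ) + 1) ≠ 0 := by positivity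
    apply mul_left_cancel₀ hn
    rw [ccoef_succ (add_pos hc hd), ← ih]
    have h1 : ((n : ℝ) + 1) * ∑ ij ∈ antidiagonal (n + 1), ccoef c ij.1 * ccoef d ij.2 =
        ∑ ij ∈ antidiagonal (n + 1), ((ij.1 : ℝ) * ccoef c ij.1) * ccoef d ij.2 +
        ∑ ij ∈ antidiagonal (n + 1), ccoef c ij.1 * ((ij.2 : ℝ) * ccoef d ij.2) := by
      rw [mul_sum, ← sum_add_distrib]
      refine sum_congr rfl fun ij hij => ?_
      have : (ij.1 : ℝ) + ij.2 = n + 1 := by exact_mod_cast mem_antidiagonal.1 hij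
      rw [← this]
      ring
    rw [h1, Nat.sum_antidiagonal_succ, Nat.sum_antidiagonal_succ']
    simp only [Nat.cast_zero, zero_mul, mul_zero, zero_add, Nat.cast_add, Nat.cast_one,
      ccoef_succ hc, ccoef_succ hd]
    rw [← sum_add_distrib, mul_sum]
    refine sum_congr rfl fun ij hij => ?_
    have : (ij.1 : ℝ) + ij.2 = n := by exact_mod_cast mem_antidiagonal.1 hij
    rw [← this]
    ring

/-- The squared weighted norm `∑ |a_n|² / c_c(n)` of a polynomial. -/
def polyNormSq (c : ℝ) (P : Polynomial ℂ) : ℝ := ∑' n : ℕ, ‖P.coeff n‖ ^ 2 / ccoef c n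

lemma summable_polyNormSq (c : ℝ) (P : Polynomial ℂ) :
    Summable fun n : ℕ => ‖P.coeff n‖ ^ 2 / ccoef c n := by
  refine summable_of_ne_finset_zero (s := P.support) fun n hn => ?_
  simp [Polynomial.notMem_support_iff.1 hn]

lemma polyNormSq_nonneg {c : ℝ} (hc : 0 < c) (P : Polynomial ℂ) : 0 ≤ polyNormSq c P :=
  tsum_nonneg fun n => by have := ccoef_pos hc n; positivity

lemma polyNormSq_pos {c : ℝ} (hc : 0 < c) {P : Polynomial ℂ} (hP : P ≠ 0) :
    0 < polyNormSq c P := by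
  have h0 : 0 < ‖P.coeff P.natDegree‖ := norm_pos_iff.2 (by simpa using hP)
  have := ccoef_pos hc P.natDegree
  refine (summable_polyNormSq c P).tsum_pos (fun n => ?_) P.natDegree (by positivity)
  have := ccoef_pos hc n
  positivity

open Finset in
lemma polyNormSq_mul_le {c d : ℝ} (hc : 0 < c) (hd : 0 < d) (P Q : Polynomial ℂ) :
    polyNormSq (c + d) (P * Q) ≤ polyNormSq c P * polyNormSq d Q := by
  have hn : ∀ (c : ℝ), 0 < c → ∀ (P : Polynomial ℂ) (n : ℕ), 0 ≤ ‖P.coeff n‖ ^ 2 / ccoef c n :=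
    fun c hc P n => by have := ccoef_pos hc n; positivity
  have hsP := summable_polyNormSq c P
  have hsQ := summable_polyNormSq d Q
  have hP := hsP.norm
  have hQ := hsQ.norm
  unfold polyNormSq
  rw [tsum_mul_tsum_eq_tsum_sum_antidiagonal_of_summable_norm hP hQ]
  refine (summable_polyNormSq (c + d) (P * Q)).tsum_le_tsum (fun n => ?_)
    (summable_norm_sum_mul_antidiagonal_of_summable_norm hP hQ).of_norm
  rw [div_le_iff₀ (ccoef_pos (add_pos hc hd) n), Polynomial.coeff_mul,
    ← sum_antidiagonal_ccoef hc hd n]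
  have h1 : ‖∑ x ∈ antidiagonal n, P.coeff x.1 * Q.coeff x.2‖ ≤
      ∑ x ∈ antidiagonal n, ‖P.coeff x.1‖ * ‖Q.coeff x.2‖ :=
    (norm_sum_le _ _).trans_eq (sum_congr rfl fun x _ => norm_mul _ _)
  refine (pow_le_pow_left₀ (norm_nonneg _) h1 2).trans ?_
  refine sum_sq_le_sum_mul_sum_of_sq_le_mul _ (fun x _ => ?_) (fun x _ => ?_)
    (fun x _ => le_of_eq ?_)
  · exact mul_nonneg (hn c hc P _) (hn d hd Q _)
  · exact (mul_pos (ccoef_pos hc _) (ccoef_pos hd _)).le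
  · have := (ccoef_pos hc x.1).ne'
    have := (ccoef_pos hd x.2).ne'
    field_simp

/-- Contractivity at even exponents. -/
lemma polyNormSq_pow_le {c : ℝ} (hc : 0 < c) (P : Polynomial ℂ) (j : ℕ) :
    polyNormSq ((j + 1 : ℕ) * c) (P ^ (j + 1)) ≤ polyNormSq c P ^ (j + 1) := by
  induction j with
  | zero => simp
  | succ j ih =>
    have h : ((j + 1 + 1 : ℕ) : ℝ) * c = (j + 1 : ℕ) * c + c := by push_cast; ring
    rw [h, pow_succ, pow_succ (polyNormSq c P)]
    exact (polyNormSq_mul_le (by positivity) hc _ _).trans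
      (mul_le_mul_of_nonneg_right ih (polyNormSq_nonneg hc P))

lemma integral_pow_mul_one_sub_rpow (n : ℕ) {s : ℝ} (hs : -1 < s) :
    ∫ x in Ioo (0 : ℝ) 1, x ^ n * (1 - x) ^ s = ProbabilityTheory.beta (n + 1) (s + 1) := by
  rw [ProbabilityTheory.beta_eq_betaIntegralReal _ _ (by positivity) (by linarith),
    Complex.betaIntegral, intervalIntegral.integral_of_le zero_le_one,
    ← integral_Ioc_eq_integral_Ioo]
  have h : ∫ x in Ioc (0 : ℝ) 1, (x : ℂ) ^ (((n + 1 : ℝ) : ℂ) - 1) *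
      (1 - (x : ℂ)) ^ (((s + 1 : ℝ) : ℂ) - 1) =
      ∫ x in Ioc (0 : ℝ) 1, ((x ^ n * (1 - x) ^ s : ℝ) : ℂ) := by
    refine setIntegral_congr_fun measurableSet_Ioc fun x hx => ?_
    have h1 : 0 ≤ 1 - x := by linarith [hx.2]
    simp only [Complex.ofReal_add, Complex.ofReal_natCast, Complex.ofReal_one,
      add_sub_cancel_right, Complex.cpow_natCast, Complex.ofReal_mul, Complex.ofReal_pow]
    rw [Complex.ofReal_cpow h1]
    simp
  rw [h, integral_complex_ofReal, Complex.ofReal_re]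

lemma integral_disk_norm_pow (n : ℕ) {s : ℝ} (hs : -1 < s) :
    ∫ z in unitDisk, ‖z‖ ^ (2 * n) * (1 - ‖z‖ ^ 2) ^ s =
      Real.pi * ProbabilityTheory.beta (n + 1) (s + 1) := by
  set G : ℝ → ℝ := (Iio 1).indicator fun t => t ^ n * (1 - t) ^ s with hG
  have h1 : ∫ z in unitDisk, ‖z‖ ^ (2 * n) * (1 - ‖z‖ ^ 2) ^ s = ∫ z : ℂ, G (‖z‖ ^ 2) := by
    rw [unitDisk, ← integral_indicator measurableSet_ball]
    congr 1
    ext z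
    have : ‖z‖ ^ 2 < 1 ↔ ‖z‖ < 1 := by simp
    by_cases hz : ‖z‖ < 1 <;> simp [hG, indicator, hz, pow_mul]
  have h2 := integral_comp_rpow_Ioi_of_pos (g := G) (p := 2) two_pos
  rw [h1, integral_fun_norm_addHaar (volume : Measure ℂ) (fun r => G (r ^ 2)),
    ← integral_pow_mul_one_sub_rpow n hs]
  have h3 : ∫ y in Ioi (0 : ℝ), G y = ∫ x in Ioo (0 : ℝ) 1, x ^ n * (1 - x) ^ s := by
    rw [hG, setIntegral_indicator measurableSet_Iio, Ioi_inter_Iio]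
  rw [← h3, ← h2]
  simp only [Complex.finrank_real_complex, Measure.real, Complex.volume_ball]
  norm_num
  rw [mul_left_comm, ← integral_const_mul]
  simp only [mul_assoc]

lemma integrableOn_disk_weight {s : ℝ} (hs : -1 < s) :
    IntegrableOn (fun z : ℂ => (1 - ‖z‖ ^ 2) ^ s) unitDisk := by
  have h := integral_disk_norm_pow 0 hs
  by_contra hi
  have h0 : ∫ z in unitDisk, (1 - ‖z‖ ^ 2) ^ s = 0 := integral_undef hi
  simp only [mul_zero, pow_zero, one_mul, h0] at h
  have : 0 < ProbabilityTheory.beta ((0 : ℕ) + 1) (s + 1) :=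
    ProbabilityTheory.beta_pos (by simp) (by linarith)
  have := mul_pos Real.pi_pos this
  linarith

lemma integrableOn_disk_weight_smul {E : Type*} [NormedAddCommGroup E] [NormedSpace ℝ E]
    [SecondCountableTopology E] {s : ℝ} (hs : -1 < s)
    {h : ℂ → E} (hh : Continuous h) :
    IntegrableOn (fun z : ℂ => (1 - ‖z‖ ^ 2) ^ s • h z) unitDisk := by
  obtain ⟨C, hC⟩ := (isCompact_closedBall (0 : ℂ) 1).exists_bound_of_continuousOn hh.continuousOn
  have hw := integrableOn_disk_weight hs
  refine hw.smul_bdd C hh.aestronglyMeasurable ?_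
  refine (ae_restrict_iff' measurableSet_ball).2 (ae_of_all _ fun z hz => ?_)
  exact hC z (Metric.ball_subset_closedBall hz)

open ComplexConjugate in
lemma integral_disk_monomial_eq_zero {s : ℝ} {m n : ℕ} (hmn : m ≠ n) :
    ∫ z in unitDisk, (1 - ‖z‖ ^ 2) ^ s • (z ^ m * conj z ^ n) = 0 := by
  set a : Circle := Circle.exp (Real.pi / ((m : ℝ) - n)) with ha
  have hmn' : (m : ℝ) - n ≠ 0 := sub_ne_zero.2 (by exact_mod_cast hmn)
  have hmn'' : (m : ℂ) - n ≠ 0 := by exact_mod_cast hmn'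
  have key : (a : ℂ) ^ m * conj (a : ℂ) ^ n = -1 := by
    rw [ha, Circle.coe_exp, ← Complex.exp_conj, ← Complex.exp_nat_mul, ← Complex.exp_nat_mul,
      ← Complex.exp_add, ← Complex.exp_pi_mul_I]
    congr 1
    simp
    field_simp
    ring
  have hpre : (rotation a) ⁻¹' unitDisk = unitDisk := by
    ext z
    simp only [unitDisk, mem_preimage, mem_ball_zero_iff, LinearIsometryEquiv.norm_map]
  have hinv := (rotation a).measurePreserving.setIntegral_preimage_emb
    (rotation a).toHomeomorph.measurableEmbedding
    (fun z : ℂ => (1 - ‖z‖ ^ 2) ^ s • (z ^ m * conj z ^ n)) unitDisk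
  rw [hpre] at hinv
  have h2 : ∀ z : ℂ, (1 - ‖rotation a z‖ ^ 2) ^ s • ((rotation a z) ^ m * conj (rotation a z) ^ n)
      = -((1 - ‖z‖ ^ 2) ^ s • (z ^ m * conj z ^ n)) := by
    intro z
    rw [LinearIsometryEquiv.norm_map, rotation_apply, map_mul, mul_pow, mul_pow, ← smul_neg]
    congr 1
    linear_combination (z ^ m * conj z ^ n) * key
  simp only [h2, integral_neg] at hinv
  exact self_eq_neg.1 hinv.symm

open ComplexConjugate in
/-- Orthogonality of monomials in weighted Bergman spaces. -/
lemma integral_disk_norm_eval_sq (P : Polynomial ℂ) {s : ℝ} (hs : -1 < s) {N : ℕ}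
    (hN : P.natDegree < N) :
    ∫ z in unitDisk, (1 - ‖z‖ ^ 2) ^ s * ‖P.eval z‖ ^ 2 =
      Real.pi * ∑ n ∈ Finset.range N, ‖P.coeff n‖ ^ 2 * ProbabilityTheory.beta (n + 1) (s + 1) := by
  have hexp : ∀ z : ℂ, (((1 - ‖z‖ ^ 2) ^ s * ‖P.eval z‖ ^ 2 : ℝ) : ℂ) =
      ∑ m ∈ Finset.range N, ∑ n ∈ Finset.range N, (P.coeff m * conj (P.coeff n)) *
        ((1 - ‖z‖ ^ 2) ^ s • (z ^ m * conj z ^ n)) := by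
    intro z
    rw [Complex.ofReal_mul, Complex.ofReal_pow, ← Complex.mul_conj',
      Polynomial.eval_eq_sum_range' hN, map_sum, Finset.sum_mul_sum, Finset.mul_sum]
    refine Finset.sum_congr rfl fun m _ => ?_
    rw [Finset.mul_sum]
    refine Finset.sum_congr rfl fun n _ => ?_
    rw [Complex.real_smul]
    simp only [map_mul, map_pow]
    ring
  have hint : ∀ m n : ℕ, IntegrableOn (fun z : ℂ => (P.coeff m * conj (P.coeff n)) *
        ((1 - ‖z‖ ^ 2) ^ s • (z ^ m * conj z ^ n))) unitDisk := fun m n =>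
    (integrableOn_disk_weight_smul hs
      (by fun_prop : Continuous fun z : ℂ => z ^ m * conj z ^ n)).const_mul _
  have hdiag : ∀ n : ℕ, ∫ z in unitDisk, (1 - ‖z‖ ^ 2) ^ s • (z ^ n * conj z ^ n) =
      ((Real.pi * ProbabilityTheory.beta (n + 1) (s + 1) : ℝ) : ℂ) := by
    intro n
    rw [← integral_disk_norm_pow n hs, ← integral_complex_ofReal]
    refine integral_congr_ae (ae_of_all _ fun z => ?_)
    simp only [Complex.real_smul]
    rw [← mul_pow, Complex.mul_conj', ← pow_mul]
    push_cast
    ring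
  apply Complex.ofReal_injective
  rw [← integral_complex_ofReal]
  simp only [hexp]
  rw [integral_finsetSum _ fun m _ => integrable_finsetSum _ fun n _ => hint m n]
  push_cast
  rw [Finset.mul_sum]
  refine Finset.sum_congr rfl fun m hm => ?_
  rw [integral_finsetSum _ fun n _ => hint m n, Finset.sum_eq_single_of_mem m hm]
  · rw [integral_const_mul, hdiag, Complex.mul_conj']
    push_cast
    ring
  · intro n _ hn
    rw [integral_const_mul, integral_disk_monomial_eq_zero hn.symm, mul_zero]

lemma beta_natCast_add_one_eq {c : ℝ} (hc : 0 < c) (n : ℕ) :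
    ProbabilityTheory.beta (n + 1) c = 1 / ((n + c) * ccoef c n) := by
  have h1 : Real.Gamma (n + c) ≠ 0 := (Real.Gamma_pos_of_pos (by positivity)).ne'
  have h2 : Real.Gamma c ≠ 0 := (Real.Gamma_pos_of_pos hc).ne'
  have h3 : (n : ℝ) + c ≠ 0 := by positivity
  have h4 : (n : ℝ) + 1 + c = (n + c) + 1 := by ring
  rw [ProbabilityTheory.beta, ccoef, h4, Real.Gamma_add_one h3, Real.Gamma_nat_eq_factorial]
  field_simp

lemma beta_natCast_add_one_add_one_eq {c : ℝ} (hc : 0 < c) (n : ℕ) :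
    ProbabilityTheory.beta (n + 1) (c + 1) =
      c / ((n + 1) * (n + 1 + c) * ccoef c (n + 1)) := by
  have h1 : Real.Gamma (n + 1 + c) ≠ 0 := (Real.Gamma_pos_of_pos (by positivity)).ne'
  have h2 : Real.Gamma c ≠ 0 := (Real.Gamma_pos_of_pos hc).ne'
  have h3 : (n : ℝ) + 1 + c ≠ 0 := by positivity
  have h4 : (n : ℝ) + 1 + (c + 1) = (n + 1 + c) + 1 := by ring
  rw [ProbabilityTheory.beta, ccoef, h4, Real.Gamma_add_one h3, Real.Gamma_nat_eq_factorial,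
    Real.Gamma_add_one hc.ne', Nat.factorial_succ]
  push_cast
  field_simp

lemma beta_natCast_add_one_sub_one_eq {c : ℝ} (hc : 1 < c) (n : ℕ) :
    ProbabilityTheory.beta (n + 1) (c - 1) = 1 / ((c - 1) * ccoef c n) := by
  have hc' : 0 < c - 1 := by linarith
  have h1 : Real.Gamma (n + c) ≠ 0 := (Real.Gamma_pos_of_pos (by positivity)).ne'
  have h2 : Real.Gamma (c - 1) ≠ 0 := (Real.Gamma_pos_of_pos hc').ne'
  have h4 : (n : ℝ) + 1 + (c - 1) = n + c := by ring
  have h5 : Real.Gamma c = (c - 1) * Real.Gamma (c - 1) := by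
    rw [← Real.Gamma_add_one hc'.ne', sub_add_cancel]
  rw [ProbabilityTheory.beta, ccoef, h4, h5, Real.Gamma_nat_eq_factorial]
  field_simp

lemma polyNormSq_eq_sum (c : ℝ) (P : Polynomial ℂ) {N : ℕ} (hN : P.natDegree < N) :
    polyNormSq c P = ∑ n ∈ Finset.range N, ‖P.coeff n‖ ^ 2 / ccoef c n := by
  refine tsum_eq_sum fun n hn => ?_
  rw [Polynomial.coeff_eq_zero_of_natDegree_lt (by simp at hn; omega)]
  simp

/-- For `c > 1` the coefficient norm is a weighted Bergman norm. -/
lemma integral_weight_eq_polyNormSq {c : ℝ} (hc : 1 < c) (P : Polynomial ℂ) :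
    (c - 1) * ∫ z in unitDisk, (1 - ‖z‖ ^ 2) ^ (c - 2) * ‖P.eval z‖ ^ 2 =
      Real.pi * polyNormSq c P := by
  have hc' : c - 1 ≠ 0 := by linarith
  rw [integral_disk_norm_eval_sq P (by linarith) (Nat.lt_succ_self _),
    polyNormSq_eq_sum c P (Nat.lt_succ_self _), mul_left_comm, Finset.mul_sum]
  congr 1
  refine Finset.sum_congr rfl fun n _ => ?_
  have h : c - 2 + 1 = c - 1 := by ring
  have := (ccoef_pos (zero_lt_one.trans hc) n).ne'
  rw [h, beta_natCast_add_one_sub_one_eq hc]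
  field_simp

/-- The coefficient norm as a sum of a weighted Dirichlet integral and a weighted Bergman norm. -/
lemma integral_derivative_add_eq_polyNormSq {c : ℝ} (hc : 0 < c) (P : Polynomial ℂ) :
    1 / c * (∫ z in unitDisk, (1 - ‖z‖ ^ 2) ^ c * ‖P.derivative.eval z‖ ^ 2) +
      c * (∫ z in unitDisk, (1 - ‖z‖ ^ 2) ^ (c - 1) * ‖P.eval z‖ ^ 2) =
      Real.pi * polyNormSq c P := by
  set N := P.natDegree + 1 with hN
  have hd : P.derivative.natDegree < N :=
    (Polynomial.natDegree_derivative_le P).trans_lt (by omega)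
  have h1 : 1 / c * (∑ n ∈ Finset.range N, ‖P.derivative.coeff n‖ ^ 2 *
      ProbabilityTheory.beta (n + 1) (c + 1)) =
      ∑ n ∈ Finset.range (N + 1), ‖P.coeff n‖ ^ 2 * (n / ((n + c) * ccoef c n)) := by
    rw [Finset.mul_sum, Finset.sum_range_succ' _ N]
    simp only [Nat.cast_zero, zero_div, mul_zero, add_zero]
    refine Finset.sum_congr rfl fun n _ => ?_
    have := (ccoef_pos hc (n + 1)).ne'
    have hn : ‖(n : ℂ) + 1‖ = n + 1 := by
      rw [← Nat.cast_add_one, Complex.norm_natCast, Nat.cast_add_one]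
    rw [beta_natCast_add_one_add_one_eq hc, Polynomial.coeff_derivative, norm_mul, hn]
    push_cast
    field_simp
  have h2 : c * (∑ n ∈ Finset.range (N + 1), ‖P.coeff n‖ ^ 2 *
      ProbabilityTheory.beta (n + 1) (c - 1 + 1)) =
      ∑ n ∈ Finset.range (N + 1), ‖P.coeff n‖ ^ 2 * (c / ((n + c) * ccoef c n)) := by
    rw [Finset.mul_sum]
    refine Finset.sum_congr rfl fun n _ => ?_
    rw [sub_add_cancel, beta_natCast_add_one_eq hc]
    ring
  rw [integral_disk_norm_eval_sq P.derivative (by linarith) hd,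
    integral_disk_norm_eval_sq P (by linarith) (by omega : P.natDegree < N + 1),
    polyNormSq_eq_sum c P (by omega : P.natDegree < N + 1), mul_left_comm, h1, mul_left_comm, h2,
    ← mul_add, ← Finset.sum_add_distrib]
  congr 1
  refine Finset.sum_congr rfl fun n _ => ?_
  have := (ccoef_pos hc n).ne'
  field_simp

/-- Comparison of two functions `φ` with prescribed `(t φ')'`. -/
lemma abs_rpow_sub_eval_le {q M ε : ℝ} (hq : 1 < q) {R Φ : Polynomial ℝ} (hΦ0 : Φ.eval 0 = 0)
    (hΦ : (Polynomial.X * Φ.derivative).derivative = R)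
    (hR : ∀ t ∈ Icc 0 M, |R.eval t - q ^ 2 * t ^ (q - 1)| ≤ ε) {t : ℝ} (ht : t ∈ Icc 0 M) :
    |t ^ q - Φ.eval t| ≤ ε * t := by
  have hpow : ∀ t : ℝ, HasDerivAt (fun t : ℝ => t ^ q) (q * t ^ (q - 1)) t := fun t =>
    Real.hasDerivAt_rpow_const (Or.inr hq.le)
  have h0 : (0 : ℝ) ∈ Icc 0 M := ⟨le_rfl, ht.1.trans ht.2⟩
  have hE : ∀ t ∈ Icc 0 M, |q * t ^ q - t * Φ.derivative.eval t| ≤ ε * t := by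
    intro t ht
    have hd : ∀ x ∈ Icc 0 M, HasDerivWithinAt
        (fun t : ℝ => q * t ^ q - (Polynomial.X * Φ.derivative).eval t)
        (q * (q * x ^ (q - 1)) - R.eval x) (Icc 0 M) x := fun x _ => by
      rw [← hΦ]
      exact (((hpow x).const_mul q).sub (Polynomial.hasDerivAt _ x)).hasDerivWithinAt
    have := (convex_Icc 0 M).norm_image_sub_le_of_norm_hasDerivWithin_le (C := ε) hd
      (fun x hx => by
        rw [Real.norm_eq_abs, abs_sub_comm]
        convert hR x hx using 3
        ring) h0 ht
    simpa [Real.zero_rpow (by linarith : q ≠ 0), abs_of_nonneg ht.1] using this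
  have hd : ∀ x ∈ Icc 0 M, HasDerivWithinAt (fun t : ℝ => t ^ q - Φ.eval t)
      (q * x ^ (q - 1) - Φ.derivative.eval x) (Icc 0 M) x := fun x _ =>
    ((hpow x).sub (Polynomial.hasDerivAt _ x)).hasDerivWithinAt
  have hb : ∀ x ∈ Icc 0 M, ‖q * x ^ (q - 1) - Φ.derivative.eval x‖ ≤ ε := by
    intro x hx
    rw [Real.norm_eq_abs]
    rcases hx.1.eq_or_lt with rfl | hx0
    · have h1 : R.eval 0 = Φ.derivative.eval 0 := by
        rw [← hΦ]
        simp [Polynomial.derivative_mul]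
      have h2 := hR 0 h0
      rw [h1, Real.zero_rpow (by linarith : q - 1 ≠ 0)] at h2
      rw [Real.zero_rpow (by linarith : q - 1 ≠ 0)]
      simpa using h2
    · have h1 := hE x hx
      have h2 : q * x ^ q - x * Φ.derivative.eval x =
          (q * x ^ (q - 1) - Φ.derivative.eval x) * x := by
        rw [Real.rpow_sub_one hx0.ne']
        field_simp
      rw [h2, abs_mul, abs_of_pos hx0] at h1
      exact le_of_mul_le_mul_right h1 hx0
  have := (convex_Icc 0 M).norm_image_sub_le_of_norm_hasDerivWithin_le hd hb h0 ht
  simpa [Real.zero_rpow (by linarith : q ≠ 0), hΦ0, abs_of_nonneg ht.1] using this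

/-- Green's formula for polynomial functions of `|P|²`. -/
lemma exists_green_polynomial {c : ℝ} (hc : 1 < c) (P : Polynomial ℂ) (R : Polynomial ℝ) :
    ∃ Φ : Polynomial ℝ, Φ.eval 0 = 0 ∧ (Polynomial.X * Φ.derivative).derivative = R ∧
      (c - 1) * (∫ z in unitDisk, (1 - ‖z‖ ^ 2) ^ (c - 2) * Φ.eval (‖P.eval z‖ ^ 2)) =
        1 / c * (∫ z in unitDisk, (1 - ‖z‖ ^ 2) ^ c *
          (‖P.derivative.eval z‖ ^ 2 * R.eval (‖P.eval z‖ ^ 2))) +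
        c * (∫ z in unitDisk, (1 - ‖z‖ ^ 2) ^ (c - 1) * Φ.eval (‖P.eval z‖ ^ 2)) := by
  induction R using Polynomial.induction_on' with
  | add R₁ R₂ h₁ h₂ =>
    obtain ⟨Φ₁, h10, h1d, h1⟩ := h₁
    obtain ⟨Φ₂, h20, h2d, h2⟩ := h₂
    have hi : ∀ (s : ℝ), -1 < s → ∀ u : ℂ → ℝ, Continuous u →
        IntegrableOn (fun z : ℂ => (1 - ‖z‖ ^ 2) ^ s * u z) unitDisk := fun s hs u hu =>
      integrableOn_disk_weight_smul hs hu
    refine ⟨Φ₁ + Φ₂, by simp [h10, h20], by simp [mul_add, ← h1d, ← h2d], ?_⟩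
    simp only [Polynomial.eval_add, mul_add]
    rw [integral_add (hi _ (by linarith) _ (by fun_prop)) (hi _ (by linarith) _ (by fun_prop)),
      integral_add (hi _ (by linarith) _ (by fun_prop)) (hi _ (by linarith) _ (by fun_prop)),
      integral_add (hi _ (by linarith) _ (by fun_prop)) (hi _ (by linarith) _ (by fun_prop))]
    linear_combination h1 + h2
  | monomial j a =>
    have hj : ((j : ℝ) + 1) ≠ 0 := by positivity
    refine ⟨Polynomial.monomial (j + 1) (a / (j + 1) ^ 2), by simp, ?_, ?_⟩
    · rw [Polynomial.derivative_monomial, Polynomial.X_mul_monomial,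
        Polynomial.derivative_monomial]
      simp only [Nat.add_sub_cancel]
      congr 1
      push_cast
      field_simp
    · have h := (integral_weight_eq_polyNormSq hc (P ^ (j + 1))).trans
        (integral_derivative_add_eq_polyNormSq (zero_lt_one.trans hc) (P ^ (j + 1))).symm
      have e1 : ∀ s : ℝ, ∀ z : ℂ, (1 - ‖z‖ ^ 2) ^ s *
          (Polynomial.monomial (j + 1) (a / (j + 1) ^ 2)).eval (‖P.eval z‖ ^ 2) =
          a / (j + 1) ^ 2 * ((1 - ‖z‖ ^ 2) ^ s * ‖(P ^ (j + 1)).eval z‖ ^ 2) := by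
        intro s z
        rw [Polynomial.eval_monomial, Polynomial.eval_pow, norm_pow]
        ring
      have e2 : ∀ z : ℂ, (1 - ‖z‖ ^ 2) ^ c *
          (‖P.derivative.eval z‖ ^ 2 * (Polynomial.monomial j a).eval (‖P.eval z‖ ^ 2)) =
          a / (j + 1) ^ 2 *
            ((1 - ‖z‖ ^ 2) ^ c * ‖(P ^ (j + 1)).derivative.eval z‖ ^ 2) := by
        intro z
        have hn : ‖(j : ℂ) + 1‖ = j + 1 := by
          rw [← Nat.cast_add_one, Complex.norm_natCast, Nat.cast_add_one]
        rw [Polynomial.eval_monomial, Polynomial.derivative_pow_succ]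
        simp only [Polynomial.eval_mul, Polynomial.eval_pow, Polynomial.eval_C,
          norm_mul, norm_pow, hn]
        field_simp
        ring
      simp only [e1, e2, integral_const_mul]
      linear_combination (a / (j + 1) ^ 2) * h

lemma abs_integral_weight_sub_le {s ε : ℝ} (hs : -1 < s) {u v b : ℂ → ℝ} (hu : Continuous u)
    (hv : Continuous v) (hb : Continuous b) (h : ∀ z ∈ unitDisk, |u z - v z| ≤ ε * b z) :
    |(∫ z in unitDisk, (1 - ‖z‖ ^ 2) ^ s * u z) - ∫ z in unitDisk, (1 - ‖z‖ ^ 2) ^ s * v z| ≤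
      ε * ∫ z in unitDisk, (1 - ‖z‖ ^ 2) ^ s * b z := by
  have hi : ∀ u : ℂ → ℝ, Continuous u →
      IntegrableOn (fun z : ℂ => (1 - ‖z‖ ^ 2) ^ s * u z) unitDisk := fun u hu =>
    integrableOn_disk_weight_smul hs hu
  rw [← integral_sub (hi u hu) (hi v hv), ← integral_const_mul, ← Real.norm_eq_abs]
  refine norm_integral_le_of_norm_le ((hi b hb).const_mul ε) ?_
  refine (ae_restrict_iff' measurableSet_ball).2 (ae_of_all _ fun z hz => ?_)
  have hz1 : ‖z‖ < 1 := mem_ball_zero_iff.1 hz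
  have hw : 0 ≤ (1 - ‖z‖ ^ 2) ^ s :=
    Real.rpow_nonneg (by nlinarith [norm_nonneg z]) _
  rw [← mul_sub, norm_mul, Real.norm_of_nonneg hw, Real.norm_eq_abs, mul_left_comm]
  exact mul_le_mul_of_nonneg_left (h z hz) hw

/-- Green's formula for `|P|^(2q)` against powers of `1 - |z|²`. -/
lemma green_rpow {c q : ℝ} (hc : 1 < c) (hq : 1 < q) (P : Polynomial ℂ) :
    (c - 1) * (∫ z in unitDisk, (1 - ‖z‖ ^ 2) ^ (c - 2) * (‖P.eval z‖ ^ 2) ^ q) =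
      1 / c * (∫ z in unitDisk, (1 - ‖z‖ ^ 2) ^ c *
        (‖P.derivative.eval z‖ ^ 2 * (q ^ 2 * (‖P.eval z‖ ^ 2) ^ (q - 1)))) +
      c * (∫ z in unitDisk, (1 - ‖z‖ ^ 2) ^ (c - 1) * (‖P.eval z‖ ^ 2) ^ q) := by
  obtain ⟨M, hM⟩ := (isCompact_closedBall (0 : ℂ) 1).exists_bound_of_continuousOn
    (by fun_prop : Continuous fun z : ℂ => ‖P.eval z‖ ^ 2).continuousOn
  have hM' : ∀ z ∈ unitDisk, ‖P.eval z‖ ^ 2 ∈ Icc 0 M := fun z hz =>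
    ⟨by positivity, (Real.le_norm_self _).trans (hM z (Metric.ball_subset_closedBall hz))⟩
  set K : ℝ := (c - 1) * (∫ z in unitDisk, (1 - ‖z‖ ^ 2) ^ (c - 2) * ‖P.eval z‖ ^ 2) +
    1 / c * (∫ z in unitDisk, (1 - ‖z‖ ^ 2) ^ c * ‖P.derivative.eval z‖ ^ 2) +
    c * (∫ z in unitDisk, (1 - ‖z‖ ^ 2) ^ (c - 1) * ‖P.eval z‖ ^ 2) with hK
  have cont1 : Continuous fun z : ℂ => (‖P.eval z‖ ^ 2) ^ q :=
    (by fun_prop : Continuous fun z : ℂ => ‖P.eval z‖ ^ 2).rpow_const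
      fun z => Or.inr (by linarith)
  have cont2 : Continuous fun z : ℂ => (‖P.eval z‖ ^ 2) ^ (q - 1) :=
    (by fun_prop : Continuous fun z : ℂ => ‖P.eval z‖ ^ 2).rpow_const
      fun z => Or.inr (by linarith)
  rw [← sub_eq_zero, ← abs_eq_zero]
  refine le_antisymm (le_of_forall_pos_le_add fun δ hδ => ?_) (abs_nonneg _)
  set ε : ℝ := δ / (|K| + 1) with hε
  have hε0 : 0 < ε := by positivity
  obtain ⟨R, hR⟩ := exists_polynomial_near_of_continuousOn 0 M
    (fun t => q ^ 2 * t ^ (q - 1))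
    (continuous_const.mul (Real.continuous_rpow_const (by linarith))).continuousOn ε hε0
  obtain ⟨Φ, hΦ0, hΦ, hG⟩ := exists_green_polynomial hc P R
  have hφ : ∀ z ∈ unitDisk, |(‖P.eval z‖ ^ 2) ^ q - Φ.eval (‖P.eval z‖ ^ 2)| ≤
      ε * ‖P.eval z‖ ^ 2 := fun z hz =>
    abs_rpow_sub_eval_le hq hΦ0 hΦ (fun t ht => (hR t ht).le) (hM' z hz)
  have b1 := abs_integral_weight_sub_le (s := c - 2) (by linarith) cont1
    (by fun_prop : Continuous fun z : ℂ => Φ.eval (‖P.eval z‖ ^ 2)) (by fun_prop) hφ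
  have b2 := abs_integral_weight_sub_le (s := c - 1) (by linarith) cont1
    (by fun_prop : Continuous fun z : ℂ => Φ.eval (‖P.eval z‖ ^ 2)) (by fun_prop) hφ
  have b3 := abs_integral_weight_sub_le (s := c) (ε := ε)
    (u := fun z => ‖P.derivative.eval z‖ ^ 2 * (q ^ 2 * (‖P.eval z‖ ^ 2) ^ (q - 1)))
    (v := fun z => ‖P.derivative.eval z‖ ^ 2 * R.eval (‖P.eval z‖ ^ 2))
    (b := fun z => ‖P.derivative.eval z‖ ^ 2) (by linarith)
    (by fun_prop) (by fun_prop) (by fun_prop) (fun z hz => by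
      rw [← mul_sub, abs_mul, abs_of_nonneg (by positivity), abs_sub_comm, mul_comm]
      exact mul_le_mul_of_nonneg_right (hR _ (hM' z hz)).le (by positivity))
  have hεK : ε * K ≤ δ := by
    rw [hε, div_mul_eq_mul_div, div_le_iff₀ (by positivity)]
    exact mul_le_mul_of_nonneg_left ((le_abs_self K).trans (by linarith)) hδ.le
  have c1 : 0 < c - 1 := by linarith
  have c2 : 0 < 1 / c := by positivity
  have c3 : 0 < c := by linarith
  rw [abs_le] at b1 b2 b3 ⊢
  have b1l := mul_le_mul_of_nonneg_left b1.1 c1.le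
  have b1r := mul_le_mul_of_nonneg_left b1.2 c1.le
  have b2l := mul_le_mul_of_nonneg_left b2.1 c3.le
  have b2r := mul_le_mul_of_nonneg_left b2.2 c3.le
  have b3l := mul_le_mul_of_nonneg_left b3.1 c2.le
  have b3r := mul_le_mul_of_nonneg_left b3.2 c2.le
  rw [hK] at hεK
  constructor <;> linarith

/-- The quantity `(1/c) ∫ |P'|² |P|^(2x-2) w^(xc) + c ∫ |P|^(2x) w^(xc-1)`, `w = 1 - |z|²`, whose
integrands are log-linear in `x`. -/
def greenEnergy (c : ℝ) (P : Polynomial ℂ) (x : ℝ) : ℝ :=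
  1 / c * (∫ z in unitDisk, (1 - ‖z‖ ^ 2) ^ (x * c) *
      (‖P.derivative.eval z‖ ^ 2 * (‖P.eval z‖ ^ 2) ^ (x - 1))) +
    c * (∫ z in unitDisk, (1 - ‖z‖ ^ 2) ^ (x * c - 1) * (‖P.eval z‖ ^ 2) ^ x)

lemma weighted_integral_eq_greenEnergy {c q : ℝ} (hc : 1 ≤ c) (hq : 1 < q) (P : Polynomial ℂ) :
    (q * c - 1) * (∫ z in unitDisk, (1 - ‖z‖ ^ 2) ^ (q * c - 2) * (‖P.eval z‖ ^ 2) ^ q) =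
      q * greenEnergy c P q := by
  have hqc : 1 < q * c := by nlinarith
  have e : ∀ z : ℂ, (1 - ‖z‖ ^ 2) ^ (q * c) *
        (‖P.derivative.eval z‖ ^ 2 * (q ^ 2 * (‖P.eval z‖ ^ 2) ^ (q - 1))) =
      q ^ 2 * ((1 - ‖z‖ ^ 2) ^ (q * c) *
        (‖P.derivative.eval z‖ ^ 2 * (‖P.eval z‖ ^ 2) ^ (q - 1))) := fun z => by ring
  rw [green_rpow hqc hq, greenEnergy]
  simp only [e, integral_const_mul]
  field_simp

lemma greenEnergy_natCast_le {c : ℝ} (hc : 0 < c) (P : Polynomial ℂ) (j : ℕ) :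
    (j + 1 : ℕ) * greenEnergy c P (j + 1 : ℕ) ≤ Real.pi * polyNormSq c P ^ (j + 1) := by
  refine le_trans (le_of_eq ?_)
    (mul_le_mul_of_nonneg_left (polyNormSq_pow_le hc P j) Real.pi_pos.le)
  rw [← integral_derivative_add_eq_polyNormSq (by positivity), greenEnergy]
  have e1 : ∀ z : ℂ, (1 - ‖z‖ ^ 2) ^ ((j + 1 : ℕ) * c) *
        ‖(P ^ (j + 1)).derivative.eval z‖ ^ 2 =
      ((j : ℝ) + 1) ^ 2 * ((1 - ‖z‖ ^ 2) ^ ((j + 1 : ℕ) * c) *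
        (‖P.derivative.eval z‖ ^ 2 * (‖P.eval z‖ ^ 2) ^ (((j + 1 : ℕ) : ℝ) - 1))) := by
    intro z
    have hn : ‖(j : ℂ) + 1‖ = j + 1 := by
      rw [← Nat.cast_add_one, Complex.norm_natCast, Nat.cast_add_one]
    have hj : ((j + 1 : ℕ) : ℝ) - 1 = (j : ℕ) := by push_cast; ring
    rw [hj, Real.rpow_natCast, Polynomial.derivative_pow_succ]
    simp only [Polynomial.eval_mul, Polynomial.eval_pow, Polynomial.eval_C,
      norm_mul, norm_pow, hn]
    ring
  have e2 : ∀ z : ℂ, (1 - ‖z‖ ^ 2) ^ ((j + 1 : ℕ) * c - 1) * ‖(P ^ (j + 1)).eval z‖ ^ 2 =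
      (1 - ‖z‖ ^ 2) ^ ((j + 1 : ℕ) * c - 1) * (‖P.eval z‖ ^ 2) ^ ((j + 1 : ℕ) : ℝ) := by
    intro z
    rw [Real.rpow_natCast, Polynomial.eval_pow, norm_pow]
    ring
  simp only [e1, e2, integral_const_mul]
  push_cast
  field_simp

/-- Weighted AM-GM inequality in the normalised form used for interpolation. -/
lemma rpow_mul_rpow_le {a b θ N A B : ℝ} (ha : 0 < a) (hb : 0 < b) (hθ0 : 0 ≤ θ) (hθ1 : θ ≤ 1)
    (hN : 0 < N) (hA : 0 ≤ A) (hB : 0 ≤ B) :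
    A ^ (1 - θ) * B ^ θ ≤ N ^ ((1 - θ) * a + θ * b) / (a ^ (1 - θ) * b ^ θ) *
      ((1 - θ) * (a / N ^ a * A) + θ * (b / N ^ b * B)) := by
  have hNa : 0 < N ^ a := Real.rpow_pos_of_pos hN _
  have hNb : 0 < N ^ b := Real.rpow_pos_of_pos hN _
  have h := Real.geom_mean_le_arith_mean2_weighted (sub_nonneg.2 hθ1) hθ0
    (by positivity : 0 ≤ a / N ^ a * A) (by positivity : 0 ≤ b / N ^ b * B) (by ring)
  refine le_trans (le_of_eq ?_) (mul_le_mul_of_nonneg_left h (by positivity))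
  rw [Real.mul_rpow (by positivity) hA, Real.mul_rpow (by positivity) hB,
    Real.div_rpow ha.le hNa.le, Real.div_rpow hb.le hNb.le, ← Real.rpow_mul hN.le,
    ← Real.rpow_mul hN.le, Real.rpow_add hN, mul_comm a, mul_comm b]
  have h1 : 0 < N ^ ((1 - θ) * a) := Real.rpow_pos_of_pos hN _
  have h2 : 0 < N ^ (θ * b) := Real.rpow_pos_of_pos hN _
  have h3 : 0 < a ^ (1 - θ) := Real.rpow_pos_of_pos ha _
  have h4 : 0 < b ^ θ := Real.rpow_pos_of_pos hb _
  field_simp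

lemma rpow_interpolate {w h s t x y θ : ℝ} (hw : 0 < w) (hh : 0 ≤ h)
    (hxy : (1 - θ) * x + θ * y ≠ 0) :
    w ^ ((1 - θ) * s + θ * t) * h ^ ((1 - θ) * x + θ * y) ≤
      (w ^ s * h ^ x) ^ (1 - θ) * (w ^ t * h ^ y) ^ θ := by
  rcases hh.eq_or_lt with rfl | hh
  · rw [Real.zero_rpow hxy, mul_zero]
    positivity
  · rw [Real.mul_rpow (by positivity) (by positivity), Real.mul_rpow (by positivity) (by positivity),
      ← Real.rpow_mul hw.le, ← Real.rpow_mul hw.le, ← Real.rpow_mul hh.le, ← Real.rpow_mul hh.le,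
      Real.rpow_add hw, Real.rpow_add hh, mul_comm s, mul_comm t, mul_comm x, mul_comm y]
    exact le_of_eq (by ring)

lemma integral_weight_interpolate {a b θ N s t x y : ℝ} (ha : 0 < a) (hb : 0 < b) (hθ0 : 0 ≤ θ)
    (hθ1 : θ ≤ 1) (hN : 0 < N) (hs : -1 < s) (ht : -1 < t) (hx : 0 ≤ x) (hy : 0 ≤ y)
    (hxy : 0 < (1 - θ) * x + θ * y) {h u : ℂ → ℝ} (hh : Continuous h) (hu : Continuous u)
    (hh0 : ∀ z, 0 ≤ h z) (hu0 : ∀ z, 0 ≤ u z) :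
    ∫ z in unitDisk, (1 - ‖z‖ ^ 2) ^ ((1 - θ) * s + θ * t) *
        (u z * h z ^ ((1 - θ) * x + θ * y)) ≤
      N ^ ((1 - θ) * a + θ * b) / (a ^ (1 - θ) * b ^ θ) *
      ((1 - θ) * (a / N ^ a * ∫ z in unitDisk, (1 - ‖z‖ ^ 2) ^ s * (u z * h z ^ x)) +
        θ * (b / N ^ b * ∫ z in unitDisk, (1 - ‖z‖ ^ 2) ^ t * (u z * h z ^ y))) := by
  have hi : ∀ (s : ℝ), -1 < s → ∀ x : ℝ, 0 ≤ x →
      IntegrableOn (fun z : ℂ => (1 - ‖z‖ ^ 2) ^ s * (u z * h z ^ x)) unitDisk :=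
    fun s hs x hx => integrableOn_disk_weight_smul hs
      (hu.mul (hh.rpow_const fun z => Or.inr hx))
  simp only [← integral_const_mul]
  rw [← integral_add (((hi s hs x hx).const_mul _).const_mul _)
    (((hi t ht y hy).const_mul _).const_mul _), ← integral_const_mul]
  have hst : -1 < (1 - θ) * s + θ * t := by
    rcases hθ0.eq_or_lt with rfl | hθ
    · linarith
    · nlinarith [mul_pos hθ (by linarith : 0 < t + 1),
        mul_nonneg (sub_nonneg.2 hθ1) (by linarith : 0 ≤ s + 1)]
  refine setIntegral_mono_on (hi _ hst _ hxy.le)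
    (((((hi s hs x hx).const_mul _).const_mul _).add
    (((hi t ht y hy).const_mul _).const_mul _)).const_mul _) measurableSet_ball fun z hz => ?_
  have hz1 : ‖z‖ < 1 := mem_ball_zero_iff.1 hz
  have hw : 0 < 1 - ‖z‖ ^ 2 := by nlinarith [norm_nonneg z]
  have hhx := Real.rpow_nonneg (hh0 z) x
  have hhy := Real.rpow_nonneg (hh0 z) y
  have := mul_le_mul_of_nonneg_left ((rpow_interpolate (s := s) (t := t) hw (hh0 z) hxy.ne').trans
    (rpow_mul_rpow_le ha hb hθ0 hθ1 hN (by positivity) (by positivity))) (hu0 z)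
  refine le_trans (le_of_eq ?_) (this.trans (le_of_eq ?_)) <;> ring

/-- The sharp-constant interpolation between two consecutive even exponents. -/
lemma greenEnergy_le {c θ N : ℝ} (hc : 1 ≤ c) {a b : ℝ} (ha : 1 ≤ a) (hb : 1 ≤ b)
    (hθ0 : 0 ≤ θ) (hθ1 : θ ≤ 1) (hN : 0 < N) (hab : 1 < (1 - θ) * a + θ * b) (P : Polynomial ℂ)
    (hPa : a * greenEnergy c P a ≤ Real.pi * N ^ a)
    (hPb : b * greenEnergy c P b ≤ Real.pi * N ^ b) :
    greenEnergy c P ((1 - θ) * a + θ * b) ≤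
      Real.pi * (N ^ ((1 - θ) * a + θ * b) / (a ^ (1 - θ) * b ^ θ)) := by
  have ha0 : 0 < a := by linarith
  have hb0 : 0 < b := by linarith
  have hc0 : 0 < c := by linarith
  have hac : 0 < a * c := by positivity
  have hbc : 0 < b * c := by positivity
  have hh : Continuous fun z : ℂ => ‖P.eval z‖ ^ 2 := by fun_prop
  have hu : Continuous fun z : ℂ => ‖P.derivative.eval z‖ ^ 2 := by fun_prop
  have h1 := integral_weight_interpolate (s := a * c) (t := b * c) (x := a - 1) (y := b - 1)
    ha0 hb0 hθ0 hθ1 hN (by linarith) (by linarith) (by linarith) (by linarith) (by linarith)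
    hh hu (fun z => by positivity) (fun z => by positivity)
  have h2 := integral_weight_interpolate (s := a * c - 1) (t := b * c - 1) (x := a) (y := b)
    ha0 hb0 hθ0 hθ1 hN (by linarith) (by linarith) ha0.le hb0.le (by linarith)
    hh (continuous_const (y := (1 : ℝ))) (fun z => by positivity) (fun z => zero_le_one)
  simp only [one_mul] at h2
  have e1 : (1 - θ) * (a * c) + θ * (b * c) = ((1 - θ) * a + θ * b) * c := by ring
  have e2 : (1 - θ) * (a - 1) + θ * (b - 1) = (1 - θ) * a + θ * b - 1 := by ring
  have e3 : (1 - θ) * (a * c - 1) + θ * (b * c - 1) = ((1 - θ) * a + θ * b) * c - 1 := by ring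
  rw [e1, e2] at h1
  rw [e3] at h2
  set κ := N ^ ((1 - θ) * a + θ * b) / (a ^ (1 - θ) * b ^ θ) with hκ
  have hκ0 : 0 ≤ κ := by positivity
  have hNa : 0 < N ^ a := Real.rpow_pos_of_pos hN _
  have hNb : 0 < N ^ b := Real.rpow_pos_of_pos hN _
  have key : greenEnergy c P ((1 - θ) * a + θ * b) ≤
      κ * ((1 - θ) * (a * greenEnergy c P a / N ^ a) + θ * (b * greenEnergy c P b / N ^ b)) := by
    have h3 := add_le_add (mul_le_mul_of_nonneg_left h1 (by positivity : 0 ≤ 1 / c))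
      (mul_le_mul_of_nonneg_left h2 hc0.le)
    refine h3.trans (le_of_eq ?_)
    simp only [greenEnergy]
    ring
  refine key.trans ?_
  rw [mul_comm Real.pi]
  refine mul_le_mul_of_nonneg_left ?_ hκ0
  have p1 := mul_le_mul_of_nonneg_left ((div_le_iff₀ hNa).2 hPa) (sub_nonneg.2 hθ1)
  have p2 := mul_le_mul_of_nonneg_left ((div_le_iff₀ hNb).2 hPb) hθ0
  linarith

/-- The inequality for polynomials. -/
lemma polynomial_weighted_le {c q : ℝ} (hc : 1 ≤ c) (m : ℕ) (hq1 : (m : ℝ) + 1 < q)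
    (hq2 : q ≤ m + 2) (P : Polynomial ℂ) :
    (q * c - 1) * (∫ z in unitDisk, (1 - ‖z‖ ^ 2) ^ (q * c - 2) * (‖P.eval z‖ ^ 2) ^ q) ≤
      Real.pi * (q / (((m : ℝ) + 1) ^ (m + 2 - q) * ((m : ℝ) + 2) ^ (q - m - 1)) *
        polyNormSq c P ^ q) := by
  have hm : (0 : ℝ) ≤ m := Nat.cast_nonneg m
  have hq : 1 < q := by linarith
  rcases eq_or_ne P 0 with rfl | hP
  · have h0 : polyNormSq c 0 = 0 := by simp [polyNormSq]
    simp [h0, Real.zero_rpow (by linarith : q ≠ 0)]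
  have hc0 : 0 < c := by linarith
  have hN := polyNormSq_pos hc0 hP
  have ha := greenEnergy_natCast_le hc0 P m
  have hb := greenEnergy_natCast_le hc0 P (m + 1)
  rw [← Real.rpow_natCast] at ha hb
  push_cast at ha hb
  have e : (m : ℝ) + 1 + 1 = m + 2 := by ring
  rw [e] at hb
  have hθ : (1 - (q - m - 1)) * ((m : ℝ) + 1) + (q - m - 1) * (m + 2) = q := by ring
  have h := greenEnergy_le (θ := q - m - 1) hc (by linarith) (by linarith) (by linarith)
    (by linarith) hN (by rw [hθ]; exact hq) P ha hb
  have e2 : 1 - (q - m - 1) = m + 2 - q := by ring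
  rw [hθ, e2] at h
  rw [weighted_integral_eq_greenEnergy hc hq]
  refine (mul_le_mul_of_nonneg_left h (by linarith)).trans (le_of_eq ?_)
  ring

/-- The `n`-th Taylor polynomial at the origin (degree less than `n`). -/
def taylorPoly (f : ℂ → ℂ) (n : ℕ) : Polynomial ℂ :=
  ∑ i ∈ Finset.range n, Polynomial.monomial i (taylorCoeff f i)

lemma coeff_taylorPoly (f : ℂ → ℂ) (n i : ℕ) :
    (taylorPoly f n).coeff i = if i < n then taylorCoeff f i else 0 := by
  simp [taylorPoly, Polynomial.finsetSum_coeff, Polynomial.coeff_monomial]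

lemma tendsto_eval_taylorPoly {f : ℂ → ℂ} (hf : DifferentiableOn ℂ f unitDisk) {z : ℂ}
    (hz : z ∈ unitDisk) : Tendsto (fun n => (taylorPoly f n).eval z) atTop (𝓝 (f z)) := by
  have h := (Complex.hasSum_taylorSeries_on_ball hf hz).tendsto_sum_nat
  refine h.congr fun n => ?_
  rw [taylorPoly, Polynomial.eval_finsetSum]
  refine Finset.sum_congr rfl fun i _ => ?_
  rw [Polynomial.eval_monomial, taylorCoeff, sub_zero, smul_eq_mul, smul_eq_mul]
  ring

lemma ofReal_polyNormSq_taylorPoly_le {α : ℝ} (hα : -1 ≤ α) (f : ℂ → ℂ) (n : ℕ) :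
    ENNReal.ofReal (polyNormSq (α + 2) (taylorPoly f n)) ≤ A2normSq α f := by
  have hc : 0 < α + 2 := by linarith
  rw [polyNormSq, ENNReal.ofReal_tsum_of_nonneg
    (fun i => by have := ccoef_pos hc i; positivity) (summable_polyNormSq _ _)]
  refine ENNReal.tsum_le_tsum fun i => ENNReal.ofReal_le_ofReal ?_
  have := ccoef_pos hc i
  rw [coeff_taylorPoly]
  split_ifs
  · exact le_rfl
  · simp only [norm_zero, ne_eq, OfNat.ofNat_ne_zero, not_false_eq_true, zero_pow, zero_div]
    positivity

lemma lintegral_polynomial_le {c q : ℝ} (hc : 1 ≤ c) (m : ℕ) (hq1 : (m : ℝ) + 1 < q)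
    (hq2 : q ≤ m + 2) (P : Polynomial ℂ) :
    ∫⁻ z in unitDisk, ENNReal.ofReal ((1 - ‖z‖ ^ 2) ^ (q * c - 2) * ‖P.eval z‖ ^ (2 * q)) ≤
      ENNReal.ofReal (Real.pi * (q / (((m : ℝ) + 1) ^ (m + 2 - q) * ((m : ℝ) + 2) ^ (q - m - 1))) /
        (q * c - 1)) * ENNReal.ofReal (polyNormSq c P) ^ q := by
  have hm : (0 : ℝ) ≤ m := Nat.cast_nonneg m
  have hqc : 0 < q * c - 1 := by nlinarith
  have hq : 0 < q := by linarith
  have hh : Continuous fun z : ℂ => ‖P.eval z‖ ^ 2 := by fun_prop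
  have e : ∀ z : ℂ, ‖P.eval z‖ ^ (2 * q) = (‖P.eval z‖ ^ 2) ^ q := fun z => by
    rw [Real.rpow_mul (norm_nonneg _), Real.rpow_two]
  have hi : IntegrableOn (fun z : ℂ => (1 - ‖z‖ ^ 2) ^ (q * c - 2) * (‖P.eval z‖ ^ 2) ^ q)
      unitDisk :=
    integrableOn_disk_weight_smul (by linarith) (hh.rpow_const fun z => Or.inr hq.le)
  simp only [e]
  rw [← ofReal_integral_eq_lintegral_ofReal hi,
    ENNReal.ofReal_rpow_of_nonneg (polyNormSq_nonneg (by linarith) P) hq.le,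
    ← ENNReal.ofReal_mul (by positivity)]
  · refine ENNReal.ofReal_le_ofReal ?_
    rw [div_mul_eq_mul_div, le_div_iff₀ hqc, mul_comm, mul_assoc Real.pi]
    exact polynomial_weighted_le hc m hq1 hq2 P
  · refine (ae_restrict_iff' measurableSet_ball).2 (ae_of_all _ fun z hz => ?_)
    have hz1 : ‖z‖ < 1 := mem_ball_zero_iff.1 hz
    have hw : 0 < 1 - ‖z‖ ^ 2 := by nlinarith [norm_nonneg z]
    simp only [Pi.zero_apply]
    positivity

lemma ApIntPow_le {α q : ℝ} (hα : -1 ≤ α) (m : ℕ) (hq1 : (m : ℝ) + 1 < q) (hq2 : q ≤ m + 2)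
    {f : ℂ → ℂ} (hf : DifferentiableOn ℂ f unitDisk) :
    ApIntPow (2 * q) (q * (α + 2) - 2) f ≤
      ENNReal.ofReal (q / (((m : ℝ) + 1) ^ (m + 2 - q) * ((m : ℝ) + 2) ^ (q - m - 1))) *
        A2normSq α f ^ q := by
  have hm : (0 : ℝ) ≤ m := Nat.cast_nonneg m
  have hc : 1 ≤ α + 2 := by linarith
  have hqc : 0 < q * (α + 2) - 1 := by nlinarith
  have hq : 0 < q := by linarith
  set C := q / (((m : ℝ) + 1) ^ (m + 2 - q) * ((m : ℝ) + 2) ^ (q - m - 1)) with hC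
  set g : ℕ → ℂ → ℝ≥0∞ := fun n z => ENNReal.ofReal
    ((1 - ‖z‖ ^ 2) ^ (q * (α + 2) - 2) * ‖(taylorPoly f n).eval z‖ ^ (2 * q)) with hg
  have hmeas : ∀ n, Measurable (g n) := fun n => by
    have h1 : Measurable fun z : ℂ => ‖(taylorPoly f n).eval z‖ :=
      (by fun_prop : Continuous fun z : ℂ => ‖(taylorPoly f n).eval z‖).measurable
    exact ((((measurable_norm.pow_const 2).const_sub 1).pow_const _).mul
      (h1.pow_const _)).ennreal_ofReal
  have hlim : ∀ z ∈ unitDisk, ENNReal.ofReal ((1 - ‖z‖ ^ 2) ^ (q * (α + 2) - 2) *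
      ‖f z‖ ^ (2 * q)) = liminf (fun n => g n z) atTop := fun z hz => by
    refine (Tendsto.liminf_eq (ENNReal.tendsto_ofReal ?_)).symm
    exact (((tendsto_eval_taylorPoly hf hz).norm).rpow_const
      (Or.inr (by positivity))).const_mul _
  have hfatou : ∫⁻ z in unitDisk, ENNReal.ofReal ((1 - ‖z‖ ^ 2) ^ (q * (α + 2) - 2) *
      ‖f z‖ ^ (2 * q)) ≤
      ENNReal.ofReal (Real.pi * C / (q * (α + 2) - 1)) * A2normSq α f ^ q := by
    rw [setLIntegral_congr_fun (s := unitDisk) measurableSet_ball hlim]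
    refine (lintegral_liminf_le hmeas).trans ?_
    refine (liminf_le_liminf (Eventually.of_forall fun n => ?_)).trans (liminf_const _).le
    refine (lintegral_polynomial_le hc m hq1 hq2 _).trans ?_
    gcongr
    exact ofReal_polyNormSq_taylorPoly_le hα f n
  rw [ApIntPow]
  have hπ := Real.pi_pos
  have h1 : q * (α + 2) - 2 + 1 = q * (α + 2) - 1 := by ring
  rw [h1]
  refine (ENNReal.div_le_div_right (mul_le_mul_right hfatou _) _).trans (le_of_eq ?_)
  rw [← mul_assoc, ← ENNReal.ofReal_mul hqc.le, mul_div_cancel₀ _ hqc.ne',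
    ENNReal.mul_div_right_comm, ← ENNReal.ofReal_div_of_pos hπ, mul_div_cancel_left₀ _ hπ.ne']

/-- if α ≥ -1 and 2(k-1) < p ≤ 2k for an integer k ≥ 2, then
‖f‖_{A^p_{(p/2)(α+2)-2}} ≤ (p/2)^{1/p} (k-1)^{1/2-k/p} k^{(k-1)/p-1/2} ‖f‖_{A²_α}. -/
theorem statement6 (α p : ℝ) (k : ℕ) (hα : -1 ≤ α) (hk : 2 ≤ k)
    (hp1 : 2 * ((k : ℝ) - 1) < p) (hp2 : p ≤ 2 * (k : ℝ)) (f : ℂ → ℂ)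
    (hf : DifferentiableOn ℂ f unitDisk) :
    ApNorm p (p / 2 * (α + 2) - 2) f ≤
      ENNReal.ofReal ((p / 2) ^ (1 / p) * ((k : ℝ) - 1) ^ (1 / 2 - (k : ℝ) / p) *
          (k : ℝ) ^ (((k : ℝ) - 1) / p - 1 / 2)) *
        A2norm α f := by
  obtain ⟨m, rfl⟩ : ∃ m : ℕ, k = m + 2 := ⟨k - 2, by omega⟩
  push_cast at hp1 hp2 ⊢
  have hm : (0 : ℝ) ≤ m := Nat.cast_nonneg m
  have hp : 0 < p := by linarith
  have hk1 : (m : ℝ) + 2 - 1 = m + 1 := by ring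
  have h := ApIntPow_le hα m (by linarith : (m : ℝ) + 1 < p / 2) (by linarith) hf
  rw [mul_div_cancel₀ p two_ne_zero] at h
  have h1 := ENNReal.rpow_le_rpow h (by positivity : 0 ≤ 1 / p)
  refine h1.trans (le_of_eq ?_)
  rw [ENNReal.mul_rpow_of_nonneg _ _ (by positivity), ← ENNReal.rpow_mul, A2norm,
    ENNReal.ofReal_rpow_of_nonneg (by positivity) (by positivity), hk1]
  have e1 : p / 2 * (1 / p) = 1 / 2 := by field_simp
  have e2 : (p / 2 / (((m : ℝ) + 1) ^ (m + 2 - p / 2) * ((m : ℝ) + 2) ^ (p / 2 - m - 1))) ^ (1 / p) =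
      (p / 2) ^ (1 / p) * ((m : ℝ) + 1) ^ (1 / 2 - ((m : ℝ) + 2) / p) *
        ((m : ℝ) + 2) ^ (((m : ℝ) + 1) / p - 1 / 2) := by
    rw [Real.div_rpow (by positivity) (by positivity), Real.mul_rpow (by positivity) (by positivity),
      ← Real.rpow_mul (by positivity), ← Real.rpow_mul (by positivity), div_eq_mul_inv, mul_inv,
      ← Real.rpow_neg (by positivity), ← Real.rpow_neg (by positivity), mul_assoc]
    congr 3
    · field_simp
      ring
    · field_simp
      ring
  rw [e1, e2]

end
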